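/- Let n ≥ 4 and let Z be a real symmetric n×n matrix. Then the sum over all ordered quadruples of pairwise distinct indices satisfies ∑_{(i,j,k,h) pairwise distinct} Z_{ij} Z_{kh} = ( ∑_{i≠j} Z_{ij} )² − 4 ∑_{(i,j,k): i≠j, j≠k, k≠i} Z_{ij} Z_{jk} − 2 ∑_{i≠j} Z_{ij}². In particular, the quadruple-indexed sum, whose direct evaluation requires O(n⁴) operations, can be computed in O(n²) operations. -/

import Mathlib

open Matrix

/-- For a real symmetric `n × n` matrix `Z` (`n ≥ 4`), the `O(n⁴)` sum of
`Z i j * Z k h` over ordered quadruples of pairwise distinct indices can be computed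
in `O(n²)` operations. -/
theorem quadruple_sum_eq
    (n : ℕ) (hn : 4 ≤ n) (Z : Matrix (Fin n) (Fin n) ℝ) (hZ : Z.IsSymm) :
    (∑ i, ∑ j, ∑ k, ∑ h,
        if i ≠ j ∧ i ≠ k ∧ i ≠ h ∧ j ≠ k ∧ j ≠ h ∧ k ≠ h then Z i j * Z k h else 0)
      = (∑ i, ∑ j, if i ≠ j then Z i j else 0) ^ 2
        - 4 * (∑ i, ∑ j, ∑ k, if i ≠ j ∧ j ≠ k ∧ k ≠ i then Z i j * Z j k else 0)
        - 2 * (∑ i, ∑ j, if i ≠ j then Z i j ^ 2 else 0) := by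
  classical
  obtain ⟨W, hW⟩ : ∃ W : Fin n → Fin n → ℝ, ∀ i j, W i j = if i ≠ j then Z i j else 0 :=
    ⟨_, fun _ _ => rfl⟩
  have hsym : ∀ i j, W i j = W j i := by
    intro i j
    rw [hW, hW, hZ.apply i j]
    simp only [ne_comm]
  have hdiag : ∀ i, W i i = 0 := by
    intro i
    simp [hW]
  -- inclusion-exclusion, term by term
  have key : ∀ i j k h : Fin n,
      (if i ≠ j ∧ i ≠ k ∧ i ≠ h ∧ j ≠ k ∧ j ≠ h ∧ k ≠ h then Z i j * Z k h else 0)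
      = W i j * W k h - (if k = i then W i j * W i h else 0)
        - (if h = i then W i j * W k i else 0)
        - (if k = j then W i j * W j h else 0)
        - (if h = j then W i j * W k j else 0)
        + (if k = i then (if h = j then W i j * W i j else 0) else 0)
        + (if k = j then (if h = i then W i j * W j i else 0) else 0) := by
    intro i j k h
    by_cases hij : i = j
    · subst hij
      simp [hdiag]
    by_cases hkh : k = h
    · subst hkh
      by_cases h1 : k = i
      · subst h1
        simp [hdiag, hij]
      by_cases h2 : k = j
      · subst h2
        simp [hdiag, hij, h1]
      simp [hdiag, h1, h2]
    have hw1 : W i j = Z i j := by simp [hW, hij]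
    have hw2 : W k h = Z k h := by simp [hW, hkh]
    rw [← hw1, ← hw2]
    by_cases h1 : k = i <;> by_cases h2 : h = i <;> by_cases h3 : k = j <;>
      by_cases h4 : h = j <;> grind
  have key3 : ∀ i j k : Fin n,
      (if i ≠ j ∧ j ≠ k ∧ k ≠ i then Z i j * Z j k else 0)
      = W i j * W j k - (if k = i then W i j * W j i else 0) := by
    intro i j k
    rw [hW i j, hW j k, hW j i]
    grind
  have key2 : ∀ i j : Fin n, (if i ≠ j then Z i j ^ 2 else 0) = W i j * W i j := by
    intro i j
    rw [hW i j]
    split_ifs <;> ring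
  have hS : (∑ i, ∑ j, if i ≠ j then Z i j else 0) = ∑ i, ∑ j, W i j := by
    simp only [hW]
  have hsq : (∑ i, ∑ j, W i j) ^ 2 = ∑ i, ∑ j, ∑ k, ∑ h, W i j * W k h := by
    simp only [sq, Finset.sum_mul, Finset.mul_sum]
    refine Finset.sum_congr rfl fun i _ => Finset.sum_congr rfl fun j _ =>
      Finset.sum_congr rfl fun k _ => Finset.sum_congr rfl fun h _ => ?_
    ring
  have hT1 : ∑ i, ∑ j, ∑ h, W i j * W i h = ∑ i, ∑ j, ∑ h, W i j * W j h := by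
    rw [Finset.sum_comm]
    refine Finset.sum_congr rfl fun i _ => Finset.sum_congr rfl fun j _ =>
      Finset.sum_congr rfl fun h _ => ?_
    rw [hsym j i]
  have hT2 : ∑ i, ∑ j, ∑ k, W i j * W k i = ∑ i, ∑ j, ∑ h, W i j * W j h := by
    rw [← hT1]
    refine Finset.sum_congr rfl fun i _ => Finset.sum_congr rfl fun j _ =>
      Finset.sum_congr rfl fun h _ => ?_
    rw [hsym h i]
  have hT3 : ∑ i, ∑ j, ∑ k, W i j * W k j = ∑ i, ∑ j, ∑ h, W i j * W j h := by
    refine Finset.sum_congr rfl fun i _ => Finset.sum_congr rfl fun j _ =>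
      Finset.sum_congr rfl fun h _ => ?_
    rw [hsym h j]
  have hQ : ∑ i, ∑ j, W i j * W j i = ∑ i, ∑ j, W i j * W i j := by
    refine Finset.sum_congr rfl fun i _ => Finset.sum_congr rfl fun j _ => ?_
    rw [hsym j i]
  have e1 : ∀ (a : Fin n) (f : Fin n → ℝ),
      ∑ k, ∑ h, (if k = a then f h else 0) = ∑ h, f h := by
    intro a f
    rw [Finset.sum_comm]
    simp
  have e2 : ∀ (a b : Fin n) (c : ℝ),
      ∑ k, ∑ h, (if k = a then (if h = b then c else 0) else 0) = c := by
    intro a b c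
    rw [e1 a (fun h => if h = b then c else 0)]
    simp
  simp only [key, key3, key2, hS, hsq, Finset.sum_sub_distrib, Finset.sum_add_distrib, e1, e2]
  simp only [Finset.sum_ite_eq', Finset.mem_univ, if_true, Finset.sum_ite_eq]
  rw [hT1, hT2, hT3, hQ]
  ring
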